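/- arXiv:2510.05546 — 2 statements merged into one kernel-verified Lean document; each statement's English description precedes it below -/
import Mathlib

section
/- Fix n ≥ 1 and real numbers α, β, c. Let R : Fin n → Fin n → Fin n → Fin n → ℂ and suppose the constant second mixed curvature condition C^{(2)}_{α,β} = c holds: for every X : Fin n → ℂ, (α:ℂ) * (∑_{i,j} Ric² i j * X i * conj (X j)) * ‖X‖² + (β:ℂ) * Q(X) = (c:ℂ) * (‖X‖²)². Then for all indices k, l: (α*(n+2) + β) * Ric² k l + β * Ric¹ k l + β * (Ric³ k l + Ric⁴ k l) = (2*(n+1)*c − α*u) * δ_{kl}. -/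
open ComplexConjugate

/-- Kronecker delta. -/
noncomputable def kdelta {n : ℕ} (i j : Fin n) : ℂ := if i = j then 1 else 0

/-- `‖X‖² = ∑ᵢ Xᵢ conj(Xᵢ)` as a complex number. -/
noncomputable def normSqC {n : ℕ} (X : Fin n → ℂ) : ℂ := ∑ i, X i * conj (X i)

/-- The quartic form `Q(X) = ∑ R i j k l Xᵢ conj(Xⱼ) Xₖ conj(X_l)`. -/
noncomputable def Qform {n : ℕ} (R : Fin n → Fin n → Fin n → Fin n → ℂ) (X : Fin n → ℂ) : ℂ :=
  ∑ i, ∑ j, ∑ k, ∑ l, R i j k l * X i * conj (X j) * X k * conj (X l)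

/-- First Chern Ricci: `Ric¹ i j = ∑ₖ R i j k k`. -/
noncomputable def ric1 {n : ℕ} (R : Fin n → Fin n → Fin n → Fin n → ℂ) (i j : Fin n) : ℂ := ∑ k, R i j k k

/-- Second Chern Ricci: `Ric² k l = ∑ᵢ R i i k l`. -/
noncomputable def ric2 {n : ℕ} (R : Fin n → Fin n → Fin n → Fin n → ℂ) (k l : Fin n) : ℂ := ∑ i, R i i k l

/-- Third Chern Ricci: `Ric³ i l = ∑ₖ R i k k l`. -/
noncomputable def ric3 {n : ℕ} (R : Fin n → Fin n → Fin n → Fin n → ℂ) (i l : Fin n) : ℂ := ∑ k, R i k k l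

/-- Fourth Chern Ricci: `Ric⁴ k j = ∑ᵢ R i j k i`. -/
noncomputable def ric4 {n : ℕ} (R : Fin n → Fin n → Fin n → Fin n → ℂ) (k j : Fin n) : ℂ := ∑ i, R i j k i

/-- Chern scalar curvature `u = ∑ᵢₖ R i i k k`. -/
noncomputable def scalarU {n : ℕ} (R : Fin n → Fin n → Fin n → Fin n → ℂ) : ℂ := ∑ i, ∑ k, R i i k k

/-- Altered Chern scalar curvature `v = ∑ᵢₖ R i k k i`. -/
noncomputable def scalarV {n : ℕ} (R : Fin n → Fin n → Fin n → Fin n → ℂ) : ℂ := ∑ i, ∑ k, R i k k i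

/-- The form `∑ T i j k l Xᵢ conj(Yⱼ) Zₖ conj(W_l)` polarizing `Qform T`. -/
noncomputable def polarForm {n : ℕ} (T : Fin n → Fin n → Fin n → Fin n → ℂ)
    (X Y Z W : Fin n → ℂ) : ℂ :=
  ∑ i, ∑ j, ∑ k, ∑ l, T i j k l * X i * conj (Y j) * Z k * conj (W l)

section polarForm

variable {n : ℕ} (T : Fin n → Fin n → Fin n → Fin n → ℂ)

lemma polarForm_add_smul_first (t : ℂ) (X X' Y Z W : Fin n → ℂ) :
    polarForm T (X + t • X') Y Z W = polarForm T X Y Z W + t * polarForm T X' Y Z W := by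
  simp only [polarForm, Finset.mul_sum, ← Finset.sum_add_distrib, Pi.add_apply, Pi.smul_apply,
    smul_eq_mul]
  congr! 4
  ring

lemma polarForm_add_smul_second (t : ℂ) (X Y Y' Z W : Fin n → ℂ) :
    polarForm T X (Y + t • Y') Z W = polarForm T X Y Z W + conj t * polarForm T X Y' Z W := by
  simp only [polarForm, Finset.mul_sum, ← Finset.sum_add_distrib, Pi.add_apply, Pi.smul_apply,
    smul_eq_mul, map_add, map_mul]
  congr! 4
  ring

lemma polarForm_add_smul_third (t : ℂ) (X Y Z Z' W : Fin n → ℂ) :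
    polarForm T X Y (Z + t • Z') W = polarForm T X Y Z W + t * polarForm T X Y Z' W := by
  simp only [polarForm, Finset.mul_sum, ← Finset.sum_add_distrib, Pi.add_apply, Pi.smul_apply,
    smul_eq_mul]
  congr! 4
  ring

lemma polarForm_add_smul_fourth (t : ℂ) (X Y Z W W' : Fin n → ℂ) :
    polarForm T X Y Z (W + t • W') = polarForm T X Y Z W + conj t * polarForm T X Y Z W' := by
  simp only [polarForm, Finset.mul_sum, ← Finset.sum_add_distrib, Pi.add_apply, Pi.smul_apply,
    smul_eq_mul, map_add, map_mul]
  congr! 4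
  ring

lemma polarForm_single (i j k l : Fin n) :
    polarForm T (Pi.single i 1) (Pi.single j 1) (Pi.single k 1) (Pi.single l 1) = T i j k l := by
  simp [polarForm, Pi.single_apply, apply_ite conj]

end polarForm

/-- The linear coefficients of a polynomial in `t` and `conj t` of bidegree at most `(2, 2)`
that vanishes identically are zero. -/
lemma linear_coeff_eq_zero {a b₁ b₂ c₁ c₂ c₃ d₁ d₂ e : ℂ}
    (h : ∀ t : ℂ, a + b₁ * t + b₂ * conj t + c₁ * t ^ 2 + c₂ * (t * conj t) + c₃ * conj t ^ 2
      + d₁ * (t ^ 2 * conj t) + d₂ * (t * conj t ^ 2) + e * (t ^ 2 * conj t ^ 2) = 0) :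
    b₁ = 0 ∧ b₂ = 0 := by
  have h1 := h 1
  have h2 := h (-1)
  have h3 := h Complex.I
  have h4 := h (-Complex.I)
  have h5 := h 2
  have h6 := h (-2)
  have h7 := h (2 * Complex.I)
  have h8 := h (-(2 * Complex.I))
  simp only [map_neg, map_mul, map_one, Complex.conj_I, map_ofNat] at h1 h2 h3 h4 h5 h6 h7 h8
  have hI : Complex.I ^ 2 = -1 := Complex.I_sq
  have p1 : b₁ + b₂ + d₁ + d₂ = 0 := by linear_combination (h1 - h2) / 2
  have p2 : b₁ + b₂ + 4 * d₁ + 4 * d₂ = 0 := by linear_combination (h5 - h6) / 4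
  have p3 : b₁ - b₂ + d₁ - d₂ = 0 := by
    linear_combination -Complex.I * (h3 - h4) / 2
      + (b₁ - b₂ + (d₁ - d₂) * (1 - Complex.I ^ 2)) * hI
  have p4 : b₁ - b₂ + 4 * d₁ - 4 * d₂ = 0 := by
    linear_combination -Complex.I * (h7 - h8) / 4
      + (b₁ - b₂ + 4 * (d₁ - d₂) * (1 - Complex.I ^ 2)) * hI
  constructor
  · linear_combination (4 * p1 - p2 + 4 * p3 - p4) / 6
  · linear_combination (4 * p1 - p2 - 4 * p3 + p4) / 6

/-- If the quartic form of `T` vanishes identically, then so does the symmetrization of `T`. -/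
lemma symmetrization_eq_zero_of_Qform_eq_zero {n : ℕ} {T : Fin n → Fin n → Fin n → Fin n → ℂ}
    (h : ∀ X, Qform T X = 0) (i j k l : Fin n) :
    T i j k l + T k j i l + T i l k j + T k l i j = 0 := by
  have h₁ (A B : Fin n → ℂ) : polarForm T B A A A + polarForm T A A B A = 0 := by
    refine (linear_coeff_eq_zero
      (a := polarForm T A A A A)
      (b₂ := polarForm T A B A A + polarForm T A A A B)
      (c₁ := polarForm T B A B A)
      (c₂ := polarForm T B B A A + polarForm T B A A B + polarForm T A B B A + polarForm T A A B B)
      (c₃ := polarForm T A B A B)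
      (d₁ := polarForm T B B B A + polarForm T B A B B)
      (d₂ := polarForm T B B A B + polarForm T A B B B)
      (e := polarForm T B B B B) fun t => ?_).1
    have := h (A + t • B)
    change polarForm T _ _ _ _ = 0 at this
    simp only [polarForm_add_smul_first, polarForm_add_smul_second, polarForm_add_smul_third,
      polarForm_add_smul_fourth] at this
    linear_combination this
  have h₂ (A B C : Fin n → ℂ) : polarForm T B C A A + polarForm T B A A C
      + polarForm T A C B A + polarForm T A A B C = 0 := by
    refine (linear_coeff_eq_zero
      (a := polarForm T B A A A + polarForm T A A B A)
      (b₁ := polarForm T B A C A + polarForm T C A B A)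
      (c₁ := 0)
      (c₂ := polarForm T B C C A + polarForm T B A C C + polarForm T C C B A + polarForm T C A B C)
      (c₃ := polarForm T B C A C + polarForm T A C B C)
      (d₁ := 0)
      (d₂ := polarForm T B C C C + polarForm T C C B C)
      (e := 0) fun t => ?_).2
    have := h₁ (A + t • C) B
    simp only [polarForm_add_smul_first, polarForm_add_smul_second, polarForm_add_smul_third,
      polarForm_add_smul_fourth] at this
    linear_combination this
  have h₃ (A B C D : Fin n → ℂ) : polarForm T B C D A + polarForm T B A D C
      + polarForm T D C B A + polarForm T D A B C = 0 := by
    refine (linear_coeff_eq_zero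
      (a := polarForm T B C A A + polarForm T B A A C + polarForm T A C B A + polarForm T A A B C)
      (b₂ := polarForm T B C A D + polarForm T B D A C + polarForm T A C B D + polarForm T A D B C)
      (c₁ := 0)
      (c₂ := polarForm T B C D D + polarForm T B D D C + polarForm T D C B D + polarForm T D D B C)
      (c₃ := 0) (d₁ := 0) (d₂ := 0) (e := 0) fun t => ?_).1
    have := h₂ (A + t • D) B C
    simp only [polarForm_add_smul_first, polarForm_add_smul_second, polarForm_add_smul_third,
      polarForm_add_smul_fourth] at this
    linear_combination this
  have := h₃ (Pi.single l 1) (Pi.single i 1) (Pi.single j 1) (Pi.single k 1)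
  simp only [polarForm_single] at this
  linear_combination this

lemma sum_kdelta_mul {n : ℕ} (X : Fin n → ℂ) :
    ∑ k, ∑ l, kdelta k l * X k * conj (X l) = normSqC X := by
  simp [kdelta, normSqC]

/-- The quartic form of a tensor product of two sesquilinear forms is the product of the forms. -/
lemma Qform_tensor {n : ℕ} (a b : Fin n → Fin n → ℂ) (X : Fin n → ℂ) :
    Qform (fun i j k l => a i j * b k l) X
      = (∑ i, ∑ j, a i j * X i * conj (X j)) * ∑ k, ∑ l, b k l * X k * conj (X l) := by
  simp only [Qform, Finset.sum_mul]
  simp only [Finset.mul_sum]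
  congr! 4
  ring

lemma Qform_combination {n : ℕ} (a b c : ℂ) (S R T : Fin n → Fin n → Fin n → Fin n → ℂ)
    (X : Fin n → ℂ) :
    Qform (fun i j k l => a * S i j k l + b * R i j k l - c * T i j k l) X
      = a * Qform S X + b * Qform R X - c * Qform T X := by
  simp only [Qform, Finset.mul_sum, ← Finset.sum_add_distrib, ← Finset.sum_sub_distrib]
  congr! 4
  ring

/-- Lemma 3.1 (equation (3.15)) in a unitary frame. -/
theorem constant_mixed2_ricci_identity (n : ℕ) (hn : 1 ≤ n) (α β c : ℝ)
    (R : Fin n → Fin n → Fin n → Fin n → ℂ)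
    (h : ∀ X : Fin n → ℂ,
      (α : ℂ) * (∑ i, ∑ j, ric2 R i j * X i * conj (X j)) * normSqC X
        + (β : ℂ) * Qform R X = (c : ℂ) * (normSqC X) ^ 2) :
    ∀ k l : Fin n,
      ((α * ((n : ℝ) + 2) + β : ℝ) : ℂ) * ric2 R k l + (β : ℂ) * ric1 R k l
          + (β : ℂ) * (ric3 R k l + ric4 R k l)
        = (2 * ((n : ℂ) + 1) * (c : ℂ) - (α : ℂ) * scalarU R) * kdelta k l := by
  intro k l
  have hT := fun i => symmetrization_eq_zero_of_Qform_eq_zero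
    (T := fun i j k l => α * (ric2 R i j * kdelta k l) + β * R i j k l
      - c * (kdelta i j * kdelta k l)) (fun X => by
        rw [Qform_combination, Qform_tensor, Qform_tensor, sum_kdelta_mul]
        linear_combination h X) i i k l
  have hu : ∑ i, ric2 R i i = scalarU R := Finset.sum_comm
  have hsum := Finset.sum_congr (rfl : Finset.univ = Finset.univ) fun i _ => hT i
  have e₁ : ∑ i, ric2 R k i * kdelta i l = ric2 R k l := by simp [kdelta]
  have e₂ : ∑ i, ric2 R i l * kdelta k i = ric2 R k l := by simp [kdelta]
  have e₃ : ∑ i : Fin n, kdelta k i * kdelta i l = kdelta k l := by simp [kdelta]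
  have e₄ : ∑ i : Fin n, kdelta i l * kdelta k i = kdelta k l := by simp [kdelta]
  have e₅ : ∑ i : Fin n, kdelta i i = (n : ℂ) := by simp [kdelta]
  simp only [Finset.sum_add_distrib, Finset.sum_sub_distrib, ← Finset.mul_sum, ← Finset.sum_mul,
    e₁, e₂, e₃, e₄, e₅, hu, Finset.sum_const_zero] at hsum
  simp only [ric1, ric3, ric4]
  rw [show ∑ i, R i i k l = ric2 R k l from rfl] at hsum
  push_cast
  linear_combination hsum
end

section
/- Fix n ≥ 1 and real numbers α, β, c. Let R : Fin n → Fin n → Fin n → Fin n → ℂ satisfy the constant third mixed curvature condition C^{(3)}_{α,β} = c: for every X : Fin n → ℂ, (α:ℂ) * (∑_{i,j} Ric³ i j * X i * conj (X j)) * ‖X‖² + (β:ℂ) * Q(X) = (c:ℂ) * (‖X‖²)². Then ((n+1)*α + β) * v + β * u = n*(n+1)*c. -/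
open ComplexConjugate

/-- The value of the quartic form at `e_a + w e_b`. -/
theorem Qform_single_add {n : ℕ} (T : Fin n → Fin n → Fin n → Fin n → ℂ) (a b : Fin n) (w : ℂ) :
    Qform T (fun i => (if i = a then 1 else 0) + if i = b then w else 0) =
      T a a a a + T b a a a * w + T a b a a * conj w + T a a b a * w + T a a a b * conj w
        + T b b a a * (w * conj w) + T b a b a * (w * w) + T b a a b * (w * conj w)
        + T a b b a * (w * conj w) + T a b a b * (conj w * conj w) + T a a b b * (w * conj w)
        + T b b b a * (w * w * conj w) + T b b a b * (w * conj w * conj w)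
        + T b a b b * (w * w * conj w) + T a b b b * (w * conj w * conj w)
        + T b b b b * (w * w * conj w * conj w) := by
  simp only [Qform, map_add, apply_ite conj, map_one, map_zero, mul_add, add_mul,
    Finset.sum_add_distrib, mul_ite, ite_mul, mul_one, mul_zero, zero_mul, Finset.sum_ite_eq',
    Finset.mem_univ, if_true]
  ring

/-- If a quartic form vanishes identically, the sum of its two full traces is zero. -/
theorem trace_add_trace_eq_zero_of_Qform_eq_zero {n : ℕ}
    (T : Fin n → Fin n → Fin n → Fin n → ℂ) (hT : ∀ X, Qform T X = 0) :
    scalarU T + scalarV T = 0 := by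
  have diag (a : Fin n) : T a a a a = 0 := by
    simpa [hT] using (Qform_single_add T a a 0).symm
  have pair (a b : Fin n) : T a a b b + T b b a a + T a b b a + T b a a b = 0 := by
    have h1 := Qform_single_add T a b 1
    have h2 := Qform_single_add T a b (-1)
    have h3 := Qform_single_add T a b Complex.I
    have h4 := Qform_single_add T a b (-Complex.I)
    simp only [hT, diag, map_one, map_neg, Complex.conj_I] at h1 h2 h3 h4
    linear_combination (-1 / 4 : ℂ) * (h1 + h2 + h3 + h4)
      + (1 / 2 : ℂ) * (T a a b b + T b b a a + T a b b a + T b a a b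
        - T b a b a - T a b a b) * Complex.I_sq
  have hsum : ∑ a, ∑ b, (T a a b b + T b b a a + T a b b a + T b a a b) = 0 := by
    simp only [pair, Finset.sum_const_zero]
  simp only [Finset.sum_add_distrib] at hsum
  rw [Finset.sum_comm (f := fun a b => T b b a a), Finset.sum_comm (f := fun a b => T b a a b)]
    at hsum
  simp only [scalarU, scalarV]
  linear_combination (1 / 2 : ℂ) * hsum

/-- The product of a Hermitian-type form with the squared norm, as a quartic form. -/
theorem Qform_mul_kdelta {n : ℕ} (A : Fin n → Fin n → ℂ) (X : Fin n → ℂ) :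
    Qform (fun i j k l => A i j * kdelta k l) X =
      (∑ i, ∑ j, A i j * X i * conj (X j)) * normSqC X := by
  simp only [Qform, kdelta, normSqC, Finset.sum_mul, mul_ite, ite_mul, mul_one, mul_zero,
    zero_mul, Finset.sum_ite_eq, Finset.mem_univ, if_true]
  refine Finset.sum_congr rfl fun i _ => Finset.sum_congr rfl fun j _ => ?_
  rw [Finset.mul_sum]
  exact Finset.sum_congr rfl fun k _ => by ring

theorem scalarU_mul_kdelta {n : ℕ} (A : Fin n → Fin n → ℂ) :
    scalarU (fun i j k l => A i j * kdelta k l) = n * ∑ i, A i i := by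
  simp [scalarU, kdelta, Finset.mul_sum]

theorem scalarV_mul_kdelta {n : ℕ} (A : Fin n → Fin n → ℂ) :
    scalarV (fun i j k l => A i j * kdelta k l) = ∑ i, A i i := by
  simp [scalarV, kdelta]

/-- Averaged scalar identity for k = 3: `((n+1)α + β) v + β u = n(n+1) c`. -/
theorem constant_mixed3_scalar_identity (n : ℕ) (hn : 1 ≤ n) (α β c : ℝ)
    (R : Fin n → Fin n → Fin n → Fin n → ℂ)
    (h : ∀ X : Fin n → ℂ,
      (α : ℂ) * (∑ i, ∑ j, ric3 R i j * X i * conj (X j)) * normSqC X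
        + (β : ℂ) * Qform R X = (c : ℂ) * (normSqC X) ^ 2) :
    ((((n : ℝ) + 1) * α + β : ℝ) : ℂ) * scalarV R + (β : ℂ) * scalarU R
      = (((n : ℝ) * ((n : ℝ) + 1) * c : ℝ) : ℂ) := by
  have key := trace_add_trace_eq_zero_of_Qform_eq_zero
    (fun i j k l => (α * ric3 R i j - c * kdelta i j) * kdelta k l + β * R i j k l) (by
      intro X
      have hA := Qform_mul_kdelta (fun i j => α * ric3 R i j - c * kdelta i j) X
      have hδ : ∑ i, ∑ j, kdelta i j * X i * conj (X j) = normSqC X := by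
        simp [kdelta, normSqC]
      have hβ : Qform (fun i j k l => β * R i j k l) X = β * Qform R X := by
        simp only [Qform, Finset.mul_sum, mul_assoc]
      have hsub : ∑ i, ∑ j, (α * ric3 R i j - c * kdelta i j) * X i * conj (X j) =
          α * (∑ i, ∑ j, ric3 R i j * X i * conj (X j)) - c * normSqC X := by
        rw [← hδ]
        simp only [Finset.mul_sum, sub_mul, Finset.sum_sub_distrib, mul_assoc]
      have hadd : Qform (fun i j k l => (α * ric3 R i j - c * kdelta i j) * kdelta k l
          + β * R i j k l) X =
          Qform (fun i j k l => (α * ric3 R i j - c * kdelta i j) * kdelta k l) X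
            + Qform (fun i j k l => β * R i j k l) X := by
        simp only [Qform, add_mul, Finset.sum_add_distrib]
      rw [hadd, hA, hβ, hsub]
      linear_combination h X)
  have hU := scalarU_mul_kdelta (fun i j => α * ric3 R i j - c * kdelta i j)
  have hV := scalarV_mul_kdelta (fun i j => α * ric3 R i j - c * kdelta i j)
  have htr : ∑ i, (α * ric3 R i i - c * kdelta i i) = α * scalarV R - n * c := by
    simp [Finset.sum_sub_distrib, kdelta, scalarV, ric3, Finset.mul_sum]
  rw [htr] at hU hV
  simp only [scalarU, scalarV, Finset.sum_add_distrib, ← Finset.mul_sum] at key hU hV ⊢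
  push_cast
  linear_combination key - hU - hV
end
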